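/- Let V be a finite-dimensional real vector space, F a family of pairwise disjoint nonempty convex cones in V each of which is open in its linear span, and f a nonempty convex cone in V. If g, h ∈ F satisfy f ⊆ closure(g) ∩ closure(h) and (g + span(f)) ∩ (h + span(f)) ≠ ∅, then g = h. In particular, the images in V/span(f) of distinct members of F having f in their closure are pairwise disjoint, so the map g ↦ (image of g in V/span(f)) is injective on {g ∈ F : f ⊆ closure(g)}. (disjointness/injectivity part of Proposition 8.2.2) -/

import Mathlib

open Pointwise

/-- A convex cone: a nonempty subset stable under addition and under multiplication by strictly
positive scalars. -/
def IsConvexCone {V : Type*} [AddCommGroup V] [Module ℝ V] (s : Set V) : Prop :=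
  s.Nonempty ∧ (∀ x ∈ s, ∀ y ∈ s, x + y ∈ s) ∧ ∀ t : ℝ, 0 < t → ∀ x ∈ s, t • x ∈ s

theorem IsConvexCone.exists_sub_eq_of_mem_span {V : Type*} [AddCommGroup V] [Module ℝ V]
    {f : Set V} (hf : IsConvexCone f) {v : V} (hv : v ∈ Submodule.span ℝ f) :
    ∃ p ∈ f, ∃ q ∈ f, v = p - q := by
  obtain ⟨⟨w, hw⟩, hadd, hsmul⟩ := hf
  induction hv using Submodule.span_induction with
  | mem x hx => exact ⟨x + w, hadd _ hx _ hw, w, hw, by abel⟩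
  | zero => exact ⟨w, hw, w, hw, by abel⟩
  | add x y _ _ hx hy =>
    obtain ⟨p, hp, q, hq, rfl⟩ := hx
    obtain ⟨p', hp', q', hq', rfl⟩ := hy
    exact ⟨p + p', hadd _ hp _ hp', q + q', hadd _ hq _ hq', by abel⟩
  | smul t x _ hx =>
    obtain ⟨p, hp, q, hq, rfl⟩ := hx
    rcases lt_trichotomy t 0 with ht | rfl | ht
    · exact ⟨(-t) • q, hsmul _ (neg_pos.2 ht) _ hq, (-t) • p, hsmul _ (neg_pos.2 ht) _ hp,
        by module⟩
    · exact ⟨w, hw, w, hw, by simp⟩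
    · exact ⟨t • p, hsmul _ ht _ hp, t • q, hsmul _ ht _ hq, smul_sub _ _ _⟩

theorem IsConvexCone.add_mem_of_mem_closure {V : Type*} [NormedAddCommGroup V]
    [NormedSpace ℝ V] [FiniteDimensional ℝ V] {g : Set V} (hg : IsConvexCone g)
    (hopen : ∃ O : Set V, IsOpen O ∧ g = O ∩ (Submodule.span ℝ g : Set V))
    {x y : V} (hx : x ∈ g) (hy : y ∈ closure g) : x + y ∈ g := by
  obtain ⟨O, hO, hgO⟩ := hopen
  have hyspan : y ∈ Submodule.span ℝ g :=
    closure_minimal Submodule.subset_span (Submodule.closed_of_finiteDimensional _) hy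
  have hxO : x ∈ O := (hgO.subset hx).1
  obtain ⟨z, hzO, hz⟩ := mem_closure_iff.1 hy ((fun z => x + (y - z)) ⁻¹' O)
    (hO.preimage (by fun_prop)) (by simpa using hxO)
  have hmem : x + (y - z) ∈ g := hgO.superset ⟨hzO, add_mem (Submodule.subset_span hx)
    (sub_mem hyspan (Submodule.subset_span hz))⟩
  have hsum := hg.2.1 _ hmem _ hz
  rwa [add_assoc, sub_add_cancel] at hsum

/-- **Proposition 8.2.2 (disjointness/injectivity part).** Let `F` be a family of pairwise
disjoint nonempty convex cones, each open in its linear span, and `f` a nonempty convex cone.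
If `g, h ∈ F` have `f` in their closures and `(g + span f) ∩ (h + span f) ≠ ∅`, then `g = h`;
in particular `g ↦ g + span f` is injective on `{g ∈ F | f ⊆ closure g}`. -/
theorem proj_cones_disjoint
    {V : Type*} [NormedAddCommGroup V] [NormedSpace ℝ V] [FiniteDimensional ℝ V]
    (F : Set (Set V))
    (hcone : ∀ g ∈ F, IsConvexCone g)
    (hopen : ∀ g ∈ F, ∃ O : Set V, IsOpen O ∧ g = O ∩ (Submodule.span ℝ g : Set V))
    (hdisj : ∀ g ∈ F, ∀ h ∈ F, g ≠ h → g ∩ h = ∅)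
    (f : Set V) (hf : IsConvexCone f) :
    (∀ g ∈ F, ∀ h ∈ F, f ⊆ closure g ∩ closure h →
        ((g + (Submodule.span ℝ f : Set V)) ∩ (h + (Submodule.span ℝ f : Set V))).Nonempty →
        g = h) ∧
    Set.InjOn (fun g : Set V => g + (Submodule.span ℝ f : Set V)) {g ∈ F | f ⊆ closure g} := by
  have key : ∀ g ∈ F, ∀ h ∈ F, f ⊆ closure g ∩ closure h →
      ((g + (Submodule.span ℝ f : Set V)) ∩ (h + (Submodule.span ℝ f : Set V))).Nonempty →
      g = h := by
    rintro g hg h hh hfgh ⟨_, ⟨a, ha, s, hs, rfl⟩, b, hb, t, ht, hab⟩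
    obtain ⟨p, hp, q, hq, hpq⟩ := hf.exists_sub_eq_of_mem_span (sub_mem hs ht)
    have hag := (hcone g hg).add_mem_of_mem_closure (hopen g hg) ha (hfgh hp).1
    have hbh := (hcone h hh).add_mem_of_mem_closure (hopen h hh) hb (hfgh hq).2
    have heq : b + q = a + p := by
      have hab' : b + t = a + s := hab
      rw [eq_sub_of_add_eq hab', eq_add_of_sub_eq hpq]
      abel
    by_contra hne
    exact (hdisj g hg h hh hne).subset ⟨hag, heq ▸ hbh⟩
  refine ⟨key, ?_⟩
  rintro g ⟨hg, hfg⟩ h ⟨hh, hfh⟩ heq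
  obtain ⟨x, hx⟩ := (hcone g hg).1
  have hmem : x + 0 ∈ g + (Submodule.span ℝ f : Set V) := Set.add_mem_add hx (zero_mem _)
  exact key g hg h hh (Set.subset_inter hfg hfh) ⟨x + 0, hmem, heq.subset hmem⟩
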